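/- Let w be a nonempty finite word with heart v. Then w is a generalized trapezoidal word if and only if v is a generalized trapezoidal word. Moreover, when w (equivalently v) is a GT-word, the set of positive lengths n ≤ |w| at which C_w attains its maximum value over {1, ..., |w|} equals the set of positive lengths n ≤ |v| at which C_v attains its maximum value over {1, ..., |v|} (i.e., the maximal interval on which C_w is constant equals the maximal interval on which C_v is constant). -/

import Mathlib

open List

variable {A : Type*} [DecidableEq A]

/-- The alphabet of a word: the finite set of distinct letters occurring in it. -/
def Alph (w : List A) : Finset A := w.toFinset

/-- The finset of all factors (contiguous subwords) of `w`. -/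
def factors (w : List A) : Finset (List A) :=
  ((Finset.range (w.length + 1)) ×ˢ (Finset.range (w.length + 1))).image
    (fun p => (w.drop p.1).take p.2)

/-- Factor complexity: the number of distinct factors of `w` of length `n`. -/
def C (w : List A) (n : ℕ) : ℕ := ((factors w).filter (fun u => u.length = n)).card

/-- Right-valence of `u` in `w`: the number of distinct letters `x` such that `u ++ [x]`
is a factor of `w`. -/
def rightValence (w u : List A) : ℕ := ((Alph w).filter (fun x => u ++ [x] <:+: w)).card

/-- `u` is a right special factor of `w`. -/
def RightSpecial (w u : List A) : Prop := u <:+: w ∧ 2 ≤ rightValence w u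

/-- `R w`: the smallest positive integer `r` such that `w` has no right special factor
of length `r`. -/
noncomputable def R (w : List A) : ℕ :=
  sInf {r : ℕ | 0 < r ∧ ∀ u : List A, u.length = r → ¬ RightSpecial w u}

/-- The number of occurrences of `u` as a factor of `w`. -/
def occCount (w u : List A) : ℕ :=
  ((Finset.range (w.length + 1)).filter
    (fun i => i + u.length ≤ w.length ∧ (w.drop i).take u.length = u)).card

/-- `K w`: the length of the shortest suffix of `w` occurring exactly once in `w`. -/
noncomputable def K (w : List A) : ℕ :=
  sInf {k : ℕ | ∃ u : List A, u <:+ w ∧ u.length = k ∧ occCount w u = 1}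

/-- Left-valence of `u` in `w`. -/
def leftValence (w u : List A) : ℕ := ((Alph w).filter (fun x => x :: u <:+: w)).card

/-- `u` is a left special factor of `w`. -/
def LeftSpecial (w u : List A) : Prop := u <:+: w ∧ 2 ≤ leftValence w u

/-- `L w`: the smallest positive integer `ℓ` such that `w` has no left special factor
of length `ℓ`. -/
noncomputable def L (w : List A) : ℕ :=
  sInf {r : ℕ | 0 < r ∧ ∀ u : List A, u.length = r → ¬ LeftSpecial w u}

/-- `H w`: the length of the shortest prefix of `w` occurring exactly once in `w`. -/
noncomputable def H (w : List A) : ℕ :=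
  sInf {k : ℕ | ∃ u : List A, u <+: w ∧ u.length = k ∧ occCount w u = 1}

/-- A generalized trapezoidal word. -/
def IsGT (w : List A) : Prop :=
  w ≠ [] ∧ ((Alph w).card = 1 ∨
    ∃ m M : ℕ, 0 < m ∧ m ≤ M ∧
      (∀ i, 1 ≤ i → i ≤ m → C w i = (Alph w).card + i - 1) ∧
      (∀ i, m ≤ i → i ≤ M - 1 → C w (i + 1) = C w i) ∧
      (∀ i, M ≤ i → i ≤ w.length → C w (i + 1) = C w i - 1))

/-- The heart of a word: remove the longest prefix and longest suffix consisting of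
letters that occur exactly once in the word (if some letter repeats); otherwise the
word itself. -/
def heart (w : List A) : List A :=
  if ∀ x ∈ w, w.count x = 1 then w
  else
    ((w.dropWhile (fun x => w.count x == 1)).reverse.dropWhile
      (fun x => w.count x == 1)).reverse

/-- A word is rich if it has exactly `|w| + 1` distinct palindromic factors. -/
def Rich (w : List A) : Prop :=
  ((factors w).filter (fun u => u.reverse = u)).card = w.length + 1

/-- `p` is a period of `w`. -/
def IsPeriod (w : List A) (p : ℕ) : Prop :=
  0 < p ∧ ∀ i : ℕ, i + p < w.length → w[i]? = w[i + p]?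

/-- The minimal period of `w`. -/
noncomputable def minPeriod (w : List A) : ℕ := sInf {p : ℕ | IsPeriod w p}

lemma mem_factors_iff (w u : List A) : u ∈ factors w ↔ u <:+: w := by
  unfold factors
  simp only [Finset.mem_image, Finset.mem_product, Finset.mem_range, Prod.exists]
  constructor
  · rintro ⟨a, b, _, rfl⟩
    exact (List.take_prefix _ _).isInfix.trans (List.drop_suffix _ _).isInfix
  · rintro ⟨s, t, rfl⟩
    refine ⟨s.length, u.length, ⟨by simp, by simp; omega⟩, ?_⟩
    simp

lemma C_zero (w : List A) (n : ℕ) (h : w.length < n) : C w n = 0 := by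
  unfold C
  rw [Finset.card_eq_zero, Finset.filter_eq_empty_iff]
  intro u hu hn
  have := ((mem_factors_iff w u).1 hu).length_le
  omega

lemma C_pos (w : List A) (n : ℕ) (h : n ≤ w.length) : 1 ≤ C w n := by
  unfold C
  rw [Nat.one_le_iff_ne_zero, Finset.card_ne_zero]
  refine ⟨w.take n, ?_⟩
  rw [Finset.mem_filter, mem_factors_iff]
  exact ⟨(List.take_prefix _ _).isInfix, by simp [h]⟩

lemma C_len (w : List A) : C w w.length = 1 := by
  unfold C
  rw [Finset.card_eq_one]
  refine ⟨w, ?_⟩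
  ext u
  rw [Finset.mem_filter, mem_factors_iff, Finset.mem_singleton]
  constructor
  · rintro ⟨h, h'⟩
    exact h.eq_of_length h'
  · rintro rfl
    exact ⟨List.infix_rfl, rfl⟩

lemma C_one_letter (w : List A) (h : (Alph w).card = 1) (n : ℕ) (hn : n ≤ w.length) :
    C w n = 1 := by
  obtain ⟨a, ha⟩ := Finset.card_eq_one.1 h
  refine le_antisymm ?_ (C_pos w n hn)
  unfold C
  rw [Finset.card_le_one]
  have key : ∀ u ∈ (factors w).filter (fun u => u.length = n), u = List.replicate n a := by
    intro u hu
    rw [Finset.mem_filter, mem_factors_iff] at hu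
    rw [List.eq_replicate_iff]
    refine ⟨hu.2, fun b hb => ?_⟩
    have : b ∈ Alph w := by
      unfold Alph
      rw [List.mem_toFinset]
      exact hu.1.subset hb
    rw [ha] at this
    simpa using this
  intro u hu u' hu'
  rw [key u hu, key u' hu']

/-- One-letter extension step on complexities. -/
def ExtStep (w u : List A) : Prop :=
  w.length = u.length + 1 ∧ (Alph w).card = (Alph u).card + 1 ∧
    ∀ n, 1 ≤ n → n ≤ u.length + 1 → C w n = C u n + 1

lemma C_insert (w u t : List A) (n : ℕ) (x : A) (hx : x ∉ u) (ht : x ∈ t)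
    (h : ∀ l : List A, (l <:+: w ∧ l.length = n) ↔ (l = t ∨ (l <:+: u ∧ l.length = n))) :
    C w n = C u n + 1 := by
  unfold C
  rw [← Finset.card_insert_of_notMem (a := t)]
  · congr 1
    ext l
    rw [Finset.mem_insert, Finset.mem_filter, Finset.mem_filter, mem_factors_iff,
      mem_factors_iff]
    exact h l
  · rw [Finset.mem_filter, mem_factors_iff]
    rintro ⟨h1, _⟩
    exact hx (h1.subset ht)

lemma ext_cons (u : List A) (x : A) (hx : x ∉ u) : ExtStep (x :: u) u := by
  refine ⟨by simp, ?_, ?_⟩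
  · unfold Alph
    rw [List.toFinset_cons, Finset.card_insert_of_notMem (by simpa using hx)]
  · intro n h1 h2
    apply C_insert (x :: u) u ((x :: u).take n) n x hx
    · obtain ⟨k, rfl⟩ : ∃ k, n = k + 1 := ⟨n - 1, by omega⟩
      simp
    · intro l
      rw [List.infix_cons_iff]
      constructor
      · rintro ⟨h | h, hn⟩
        · left
          rw [← hn]
          exact List.prefix_iff_eq_take.1 h
        · exact Or.inr ⟨h, hn⟩
      · rintro (rfl | h)
        · exact ⟨Or.inl (List.take_prefix _ _), by simp; omega⟩
        · exact ⟨Or.inr h.1, h.2⟩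

lemma ext_concat (u : List A) (x : A) (hx : x ∉ u) : ExtStep (u ++ [x]) u := by
  refine ⟨by simp, ?_, ?_⟩
  · unfold Alph
    rw [List.toFinset_append, Finset.union_comm]
    simp only [List.toFinset_cons, List.toFinset_nil, insert_empty_eq]
    rw [← Finset.insert_eq, Finset.card_insert_of_notMem (by simpa using hx)]
  · intro n h1 h2
    apply C_insert (u ++ [x]) u ((u ++ [x]).drop (u.length + 1 - n)) n x hx
    · rw [List.drop_append_of_le_length (by omega)]
      simp
    · intro l
      rw [List.infix_concat_iff]
      constructor
      · rintro ⟨h | h, hn⟩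
        · left
          have := List.suffix_iff_eq_drop.1 h
          simpa [hn] using this
        · exact Or.inr ⟨h, hn⟩
      · rintro (rfl | h)
        · exact ⟨Or.inl (List.drop_suffix _ _), by simp; omega⟩
        · exact ⟨Or.inr h.1, h.2⟩

/-- The trapezoidal condition with parameters. -/
def Trap (w : List A) (m M : ℕ) : Prop :=
  0 < m ∧ m ≤ M ∧
      (∀ i, 1 ≤ i → i ≤ m → C w i = (Alph w).card + i - 1) ∧
      (∀ i, m ≤ i → i ≤ M - 1 → C w (i + 1) = C w i) ∧
      (∀ i, M ≤ i → i ≤ w.length → C w (i + 1) = C w i - 1)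

lemma isGT_iff (w : List A) : IsGT w ↔ w ≠ [] ∧ ∃ m M, Trap w m M := by
  unfold IsGT
  refine and_congr_right fun hw => ?_
  constructor
  · rintro (h | h)
    · have hl : 0 < w.length := List.length_pos_iff.2 hw
      refine ⟨1, w.length, by omega, by omega, ?_, ?_, ?_⟩
      · intro i h1 h2
        rw [C_one_letter w h i (by omega), h]
        omega
      · intro i h1 h2
        rw [C_one_letter w h i (by omega), C_one_letter w h (i + 1) (by omega)]
      · intro i h1 h2
        rw [C_one_letter w h i (by omega), C_zero w (i + 1) (by omega)]
    · exact h
  · exact Or.inr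

lemma alph_pos (u : List A) (hu : u ≠ []) : 1 ≤ (Alph u).card := by
  rw [Nat.one_le_iff_ne_zero, Finset.card_ne_zero]
  obtain ⟨a, ha⟩ := List.exists_mem_of_ne_nil u hu
  exact ⟨a, by simpa [Alph] using ha⟩

lemma trap_const (w : List A) (m M : ℕ) (h : Trap w m M) (i : ℕ) (h1 : m ≤ i) (h2 : i ≤ M) :
    C w i = (Alph w).card + m - 1 := by
  obtain ⟨a, b, c, d, e⟩ := h
  induction i, h1 using Nat.le_induction with
  | base => exact c m a le_rfl
  | succ i hi ih => rw [d i hi (by omega)]; exact ih (by omega)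

lemma trap_le (w : List A) (hw : w ≠ []) (m M : ℕ) (h : Trap w m M) : M ≤ w.length := by
  by_contra hc
  have h1 := trap_const w m M h M h.2.1 le_rfl
  rw [C_zero w M (by omega)] at h1
  have := alph_pos w hw
  have := h.1
  omega

lemma ext_trap (w u : List A) (hu : u ≠ []) (h : ExtStep w u) (m M : ℕ) :
    Trap w m M ↔ Trap u m M := by
  obtain ⟨hl, ha, hC⟩ := h
  have hw : w ≠ [] := by
    rintro rfl
    simp at hl
  have hp := alph_pos u hu
  have hM : (Trap w m M ∨ Trap u m M) → M ≤ u.length := by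
    rintro (h | h)
    · have h0 := trap_le w hw m M h
      by_contra hc
      have h1 := trap_const w m M h M h.2.1 le_rfl
      have h2 := C_len w
      have : M = w.length := by omega
      rw [this, h2] at h1
      have := h.1
      omega
    · exact trap_le u hu m M h
  constructor
  · intro h
    have hM := hM (Or.inl h)
    obtain ⟨a, b, c, d, e⟩ := h
    refine ⟨a, b, ?_, ?_, ?_⟩
    · intro i h1 h2
      have := c i h1 h2
      rw [hC i h1 (by omega)] at this
      omega
    · intro i h1 h2
      have := d i h1 h2
      rw [hC i (by omega) (by omega), hC (i + 1) (by omega) (by omega)] at this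
      omega
    · intro i h1 h2
      have := e i h1 (by omega)
      rw [hC i (by omega) (by omega), hC (i + 1) (by omega) (by omega)] at this
      omega
  · intro h
    have hM := hM (Or.inr h)
    obtain ⟨a, b, c, d, e⟩ := h
    refine ⟨a, b, ?_, ?_, ?_⟩
    · intro i h1 h2
      have := c i h1 h2
      rw [hC i h1 (by omega)]
      omega
    · intro i h1 h2
      have := d i h1 h2
      rw [hC i (by omega) (by omega), hC (i + 1) (by omega) (by omega)]
      omega
    · intro i h1 h2
      by_cases hi : i ≤ u.length
      · have := e i h1 (by omega)
        have := C_pos u i hi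
        rw [hC i (by omega) (by omega), hC (i + 1) (by omega) (by omega)]
        omega
      · have : i = w.length := by omega
        rw [this, C_len, C_zero w _ (by omega)]

/-- The lengths at which the complexity is maximal. -/
def maxSet (w : List A) : Set ℕ :=
  {n : ℕ | 1 ≤ n ∧ n ≤ w.length ∧ ∀ k, 1 ≤ k → k ≤ w.length → C w k ≤ C w n}

lemma ext_max (w u : List A) (hu : u ≠ []) (h : ExtStep w u) : maxSet w = maxSet u := by
  obtain ⟨hl, _, hC⟩ := h
  have hul : 0 < u.length := List.length_pos_iff.2 hu
  have hw := C_len w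
  have h1 := C_pos u 1 hul
  ext n
  simp only [maxSet, Set.mem_setOf_eq]
  constructor
  · rintro ⟨a, b, c⟩
    have hn : n ≤ u.length := by
      by_contra hn
      have : n = w.length := by omega
      have h2 := c 1 le_rfl (by omega)
      rw [this, hw, hC 1 le_rfl (by omega)] at h2
      omega
    refine ⟨a, hn, fun k k1 k2 => ?_⟩
    have := c k k1 (by omega)
    rw [hC k k1 (by omega), hC n a (by omega)] at this
    omega
  · rintro ⟨a, b, c⟩
    refine ⟨a, by omega, fun k k1 k2 => ?_⟩
    rw [hC n a (by omega)]
    by_cases hk : k ≤ u.length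
    · have := c k k1 hk
      rw [hC k k1 (by omega)]
      omega
    · have : k = w.length := by omega
      rw [this, hw]
      omega

/-- Two words agree on being GT and on the maximality set. -/
def Same (w u : List A) : Prop := (IsGT w ↔ IsGT u) ∧ maxSet w = maxSet u

lemma Same.comp {a b c : List A} (h : Same a b) (h' : Same b c) : Same a c :=
  ⟨h.1.trans h'.1, h.2.trans h'.2⟩

lemma ext_same (w u : List A) (hu : u ≠ []) (h : ExtStep w u) : Same w u := by
  refine ⟨?_, ext_max w u hu h⟩
  have hw : w ≠ [] := by
    rintro rfl
    have := h.1
    simp at this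
  rw [isGT_iff, isGT_iff]
  simp only [ext_trap w u hu h, hw, hu, ne_eq, not_false_eq_true, true_and]

lemma same_prefix (r v : List A) (hv : v ≠ []) (h : ∀ x ∈ r, (r ++ v).count x = 1) :
    Same (r ++ v) v := by
  induction r with
  | nil => exact ⟨Iff.rfl, rfl⟩
  | cons x r ih =>
    have hx : x ∉ r ++ v := by
      have := h x (by simp)
      rw [List.cons_append, List.count_cons_self] at this
      exact List.count_eq_zero.1 (by omega)
    refine (ext_same (x :: (r ++ v)) (r ++ v) (by simp [hv]) (ext_cons _ x hx)).comp (ih ?_)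
    intro y hy
    have := h y (by simp [hy])
    have hne : x ≠ y := by
      rintro rfl
      exact hx (by simp [hy])
    rwa [List.cons_append, List.count_cons_of_ne hne] at this

lemma same_suffix (s v : List A) (hv : v ≠ []) (h : ∀ x ∈ s, (v ++ s).count x = 1) :
    Same (v ++ s) v := by
  induction s using List.reverseRecOn with
  | nil => rw [List.append_nil]; exact ⟨Iff.rfl, rfl⟩
  | append_singleton s x ih =>
    rw [← List.append_assoc] at h ⊢
    have hx : x ∉ v ++ s := by
      have := h x (by simp)
      rw [List.count_append, List.count_singleton_self] at this
      exact List.count_eq_zero.1 (by omega)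
    refine (ext_same (v ++ s ++ [x]) (v ++ s) (by simp [hv]) (ext_concat _ x hx)).comp (ih ?_)
    intro y hy
    have := h y (by simp [hy])
    have hne : x ≠ y := by
      rintro rfl
      exact hx (by simp [hy])
    rw [List.count_append, List.count_singleton] at this
    simpa [hne] using this

lemma heart_same (w : List A) : Same w (heart w) := by
  unfold heart
  split_ifs with hc
  · exact ⟨Iff.rfl, rfl⟩
  · set p : A → Bool := fun x => w.count x == 1 with hp
    set r := w.takeWhile p with hr
    set t := w.dropWhile p with ht
    set v := (t.reverse.dropWhile p).reverse with hv
    set s := (t.reverse.takeWhile p).reverse with hs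
    have hw : r ++ t = w := List.takeWhile_append_dropWhile
    have htt : v ++ s = t := by
      rw [hv, hs, ← List.reverse_append, List.takeWhile_append_dropWhile, List.reverse_reverse]
    have hrc : ∀ x ∈ r, w.count x = 1 := by
      intro x hx
      have := List.mem_takeWhile_imp hx
      simpa [hp] using this
    have hsc : ∀ x ∈ s, w.count x = 1 := by
      intro x hx
      rw [hs, List.mem_reverse] at hx
      have := List.mem_takeWhile_imp hx
      simpa [hp] using this
    have hvne : v ≠ [] := by
      intro h0
      apply hc
      intro x hx
      rw [← hw, ← htt, h0, List.nil_append, List.mem_append] at hx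
      exact hx.elim (hrc x) (hsc x)
    have h1 : Same (r ++ t) t := by
      apply same_prefix
      · rw [← htt]
        simp [hvne]
      · rw [hw]
        exact hrc
    rw [hw] at h1
    refine h1.comp ?_
    have h2 : Same (v ++ s) v := by
      apply same_suffix _ _ hvne
      intro x hx
      have h3 := hsc x hx
      rw [← hw, ← htt, List.count_append] at h3
      have h4 : 0 < (v ++ s).count x := List.count_pos_iff.2 (by simp [hx])
      omega
    rwa [htt] at h2

theorem stmt9 (w : List A) (hw : w ≠ []) (v : List A) (hv : v = heart w) :
    (IsGT w ↔ IsGT v) ∧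
    (IsGT w →
      {n : ℕ | 1 ≤ n ∧ n ≤ w.length ∧
        ∀ k, 1 ≤ k → k ≤ w.length → C w k ≤ C w n} =
      {n : ℕ | 1 ≤ n ∧ n ≤ v.length ∧
        ∀ k, 1 ≤ k → k ≤ v.length → C v k ≤ C v n}) := by
  subst hv
  exact ⟨(heart_same w).1, fun _ => (heart_same w).2⟩
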